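/- Let K be a field, P_0 = K[x_1,…,x_m], P = K[x_1,…,x_m,y_1,…,y_n] bigraded with deg x_i = (1,0) and deg y_j = (0,1), P_+ = (y_1,…,y_n), f ∈ P a bihomogeneous polynomial, and R = P/fP. Write f = Σ_{|β|=b} f_β y^β with f_β ∈ P_0 and let I(f) ⊆ P_0 be the ideal generated by all coefficients f_β. Then dim_{P_0} H^n_{P_+}(R)_j ≤ dim P_0/I(f) for all j ≤ −n. In particular, if I(f) is m-primary, where m = (x_1,…,x_m) is the graded maximal ideal of P_0, then H^n_{P_+}(R)_j is a P_0-module of finite length for all j ≤ −n. -/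

import Mathlib

/-!
Formalization of a statement from "On the regularity of local cohomology of bigraded algebras"
(A. Rahimi). Here `P₀ = K[x₁,…,x_m]`, `P = P₀[y₁,…,yₙ]` is bigraded with `deg xᵢ = (1,0)`,
`deg yⱼ = (0,1)`, and `P₊ = (y₁,…,yₙ)`.  The top local cohomology `H^n_{P₊}(P)` is the free
`P₀`-module `⊕_c P₀ z^c` (`c : Fin n →₀ ℕ`, `z^c` of bidegree `(0, -n - |c|)`), on which a
bihomogeneous `f = Σ_β f_β y^β ∈ P` acts by the contraction `f ⬝ z^c = Σ_{β ≤ c} f_β z^{c-β}`.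
For a hypersurface ring `R = P/fP` this yields the exact presentation
`⊕_{|c| = -n-j+b} P₀(-a) z^c → ⊕_{|c| = -n-j} P₀ z^c → H^n_{P₊}(R)_j → 0`
(with `(a,b) = bideg f`), and `H^{n-1}_{P₊}(R)_j` is the kernel of the first map.
-/

open MvPolynomial

namespace Paper

/-- Total degree of an exponent vector. -/
def tdeg {n : ℕ} (c : Fin n →₀ ℕ) : ℕ := c.sum fun _ e => e

variable (A : Type) [CommRing A] (n : ℕ)

/-- The underlying module of the top local cohomology `H^n_{P₊}(P)` of `P = A[y₁,…,yₙ]`: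
the free `A`-module with basis `z^c`, `c : Fin n →₀ ℕ` (`z^c` lies in `y`-degree `-n - |c|`). -/
abbrev Wmod := (Fin n →₀ ℕ) →₀ A

/-- The free `A`-submodule of `Wmod` spanned by the `z^c` with `|c| = k`;
this is the graded component `H^n_{P₊}(P)_j` for `j = -n-k`. -/
noncomputable def Fk (k : ℕ) : Submodule A (Wmod A n) :=
  Finsupp.supported A A {c | tdeg c = k}

open scoped Classical in
/-- The contraction action of `f ∈ P = A[y₁,…,yₙ]` on `H^n_{P₊}(P)`:
`f ⬝ z^c = Σ_{β ≤ c} f_β z^{c-β}`, where `f = Σ_β f_β y^β` with `f_β ∈ A`. -/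
noncomputable def contract (f : MvPolynomial (Fin n) A) :
    Wmod A n →ₗ[A] Wmod A n :=
  Finsupp.lsum A fun c =>
    (LinearMap.id : A →ₗ[A] A).smulRight
      (f.support.sum fun β => if β ≤ c then Finsupp.single (c - β) (MvPolynomial.coeff β f) else 0)

variable (K : Type) [Field K] (m : ℕ)

/-- `f ∈ P = K[x₁,…,x_m][y₁,…,yₙ]` is bihomogeneous of bidegree `(a,b)`:
every monomial `x^ν y^β` occurring in `f` has `|ν| = a` and `|β| = b`. -/
def IsBihom (f : MvPolynomial (Fin n) (MvPolynomial (Fin m) K)) (a b : ℕ) : Prop :=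
  ∀ β ν, MvPolynomial.coeff ν (MvPolynomial.coeff β f) ≠ 0 → tdeg ν = a ∧ tdeg β = b

/-- The `x`-degree-`i` strand of `Wmod` (coefficients homogeneous of degree `i`). -/
def strandW (i : ℤ) : Submodule K (Wmod (MvPolynomial (Fin m) K) n) where
  carrier := {w | ∀ c ν, MvPolynomial.coeff ν (w c) ≠ 0 → (tdeg ν : ℤ) = i}
  add_mem' := by
    intro a b ha hb c ν h
    rw [Finsupp.add_apply, MvPolynomial.coeff_add] at h
    by_cases h1 : MvPolynomial.coeff ν (a c) ≠ 0
    · exact ha c ν h1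
    · push_neg at h1
      exact hb c ν (by simpa [h1] using h)
  zero_mem' := by intro c ν h; simp at h
  smul_mem' := by
    intro k w hw c ν h
    rw [Finsupp.smul_apply, MvPolynomial.coeff_smul] at h
    exact hw c ν (right_ne_zero_of_smul h)

/-- The submodule `U_j ⊆ F_j = ⊕_{|c| = t} P₀ z^c` (`j = -n-t`): the image of
`⊕_{|c| = t+b} P₀(-a) z^c` under multiplication by `f` on `H^n_{P₊}(P)`. -/
noncomputable def Uf (f : MvPolynomial (Fin n) (MvPolynomial (Fin m) K)) (t b : ℕ) :
    Submodule (MvPolynomial (Fin m) K) (Wmod (MvPolynomial (Fin m) K) n) :=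
  Submodule.map (contract (MvPolynomial (Fin m) K) n f) (Fk (MvPolynomial (Fin m) K) n (t + b))

/-- The graded component `H^n_{P₊}(P/fP)_j`, `j = -n-t`, realized as the image of
`F_j = ⊕_{|c| = t} P₀ z^c` in `Wmod/U_j`; i.e. the cokernel `F_j/U_j` of the presentation. -/
noncomputable def topH (f : MvPolynomial (Fin n) (MvPolynomial (Fin m) K)) (t b : ℕ) :
    Submodule (MvPolynomial (Fin m) K)
      ((Wmod (MvPolynomial (Fin m) K) n) ⧸ Uf n K m f t b) :=
  Submodule.map (Uf n K m f t b).mkQ (Fk (MvPolynomial (Fin m) K) n t)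

/-- The `x`-degree-`i` component of `H^n_{P₊}(P/fP)_j`, `j = -n-t`, inside `Wmod/U_j`. -/
noncomputable def topHcomp (f : MvPolynomial (Fin n) (MvPolynomial (Fin m) K)) (t b : ℕ)
    (i : ℤ) : Submodule K ((Wmod (MvPolynomial (Fin m) K) n) ⧸ Uf n K m f t b) :=
  Submodule.map ((Uf n K m f t b).mkQ.restrictScalars K)
    (strandW n K m i ⊓ (Fk (MvPolynomial (Fin m) K) n t).restrictScalars K)

/-- The grading (by `x`-degree) of `H^n_{P₊}(P/fP)_j`, `j = -n-t`. -/
noncomputable def topHgr (f : MvPolynomial (Fin n) (MvPolynomial (Fin m) K)) (t b : ℕ)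
    (i : ℤ) : Submodule K ↥(topH n K m f t b) :=
  Submodule.comap ((topH n K m f t b).subtype.restrictScalars K) (topHcomp n K m f t b i)

/-- `H^{n-1}_{P₊}(P/fP)_j`, `j = -n-t`: the kernel of multiplication by `f` from
`⊕_{|c| = t+b} P₀(-a) z^c` to `⊕_{|c| = t} P₀ z^c`. -/
noncomputable def syzM (f : MvPolynomial (Fin n) (MvPolynomial (Fin m) K)) (t b : ℕ) :
    Submodule (MvPolynomial (Fin m) K) (Wmod (MvPolynomial (Fin m) K) n) :=
  LinearMap.ker (contract (MvPolynomial (Fin m) K) n f) ⊓ Fk (MvPolynomial (Fin m) K) n (t + b)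

/-- The grading of `H^{n-1}_{P₊}(P/fP)_j`, `j = -n-t`: since it lives inside
`⊕_{|c| = t+b} P₀(-a) z^c`, its degree-`i` component consists of the elements whose
coefficients are homogeneous of degree `i - a`. -/
noncomputable def syzGr (f : MvPolynomial (Fin n) (MvPolynomial (Fin m) K)) (t b a : ℕ)
    (i : ℤ) : Submodule K ↥(syzM n K m f t b) :=
  Submodule.comap ((syzM n K m f t b).subtype.restrictScalars K) (strandW n K m (i - a))

lemma tdeg_eq_degree {n : ℕ} (c : Fin n →₀ ℕ) : tdeg c = c.degree := rfl

lemma tdeg_finite (n t : ℕ) : {c : Fin n →₀ ℕ | tdeg c = t}.Finite :=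
  (Finsupp.finite_of_degree_le t).subset fun c hc => by
    have : tdeg c = t := hc
    rw [tdeg_eq_degree] at this
    exact this.le

lemma contract_single (A : Type) [CommRing A] (n : ℕ) (f : MvPolynomial (Fin n) A)
    (c : Fin n →₀ ℕ) :
    contract A n f (Finsupp.single c 1) = ∑ β ∈ f.support,
      if β ≤ c then Finsupp.single (c - β) (MvPolynomial.coeff β f) else 0 := by
  classical
  rw [contract, Finsupp.lsum_single]
  simp only [LinearMap.smulRight_apply, LinearMap.id_apply, one_smul]

/-- A functional killing the contractions gives a polynomial killed by `f`. -/
lemma coeffs_zero_of_functional (A : Type) [CommRing A] (n : ℕ) (f : MvPolynomial (Fin n) A)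
    (t b : ℕ) (hf : ∀ β, MvPolynomial.coeff β f ≠ 0 → tdeg β = b)
    (L : Type) [CommRing L] [IsDomain L] [Algebra A L] (χ : Wmod A n →ₗ[A] L)
    (hχ : ∀ c, tdeg c ≠ t → χ (Finsupp.single c 1) = 0)
    (hne : ∃ c, χ (Finsupp.single c 1) ≠ 0)
    (hk : ∀ c, tdeg c = t + b → χ (contract A n f (Finsupp.single c 1)) = 0) (β : Fin n →₀ ℕ) :
    algebraMap A L (MvPolynomial.coeff β f) = 0 := by
  classical
  let g : MvPolynomial (Fin n) L :=
    ∑ c ∈ (tdeg_finite n t).toFinset, MvPolynomial.monomial c (χ (Finsupp.single c 1))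
  have hg : ∀ c, MvPolynomial.coeff c g = χ (Finsupp.single c 1) := by
    intro c
    simp only [g, MvPolynomial.coeff_sum, MvPolynomial.coeff_monomial]
    rw [Finset.sum_ite_eq']
    split_ifs with h
    · rfl
    · exact (hχ c (by simpa using h)).symm
  have hg0 : g ≠ 0 := by
    obtain ⟨c, hc⟩ := hne
    intro h
    apply hc
    rw [← hg, h, MvPolynomial.coeff_zero]
  have hmul : MvPolynomial.map (algebraMap A L) f * g = 0 := by
    ext c
    have e : MvPolynomial.map (algebraMap A L) f =
        ∑ β ∈ f.support, MvPolynomial.monomial β (algebraMap A L (MvPolynomial.coeff β f)) := by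
      have h0 := congrArg (MvPolynomial.map (algebraMap A L)) f.as_sum
      rw [map_sum] at h0
      simpa only [MvPolynomial.map_monomial] using h0
    rw [e, Finset.sum_mul, MvPolynomial.coeff_sum, MvPolynomial.coeff_zero]
    simp only [MvPolynomial.coeff_monomial_mul', hg]
    by_cases hc : tdeg c = t + b
    · have hk' := hk c hc
      rw [contract_single, map_sum] at hk'
      refine Eq.trans ?_ hk'
      refine Finset.sum_congr rfl fun γ _ => ?_
      split_ifs
      · rw [← Algebra.smul_def, ← map_smul, Finsupp.smul_single, smul_eq_mul, mul_one]
      · exact (map_zero χ).symm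
    · refine Finset.sum_eq_zero fun γ hγ => ?_
      split_ifs with hle
      · rw [hχ, mul_zero]
        intro h
        apply hc
        have h1 := hf γ (MvPolynomial.mem_support_iff.mp hγ)
        rw [← tsub_add_cancel_of_le hle, ← h, ← h1]
        simp only [tdeg_eq_degree, map_add]
      · rfl
  have hz : MvPolynomial.map (algebraMap A L) f = 0 :=
    (mul_eq_zero.mp hmul).resolve_right hg0
  rw [← MvPolynomial.coeff_map, hz, MvPolynomial.coeff_zero]

lemma bihom_y {K : Type} [Field K] {m n : ℕ}
    {f : MvPolynomial (Fin n) (MvPolynomial (Fin m) K)} {a b : ℕ}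
    (hf : IsBihom n K m f a b) (β : Fin n →₀ ℕ) (h : MvPolynomial.coeff β f ≠ 0) :
    tdeg β = b := by
  obtain ⟨ν, hν⟩ := MvPolynomial.ne_zero_iff.mp h
  exact (hf β ν hν).2

lemma contract_single_mem (A : Type) [CommRing A] (n : ℕ) (f : MvPolynomial (Fin n) A)
    (t b : ℕ) (hf : ∀ β, MvPolynomial.coeff β f ≠ 0 → tdeg β = b)
    (c : Fin n →₀ ℕ) (hc : tdeg c = t + b) :
    contract A n f (Finsupp.single c 1) ∈ Fk A n t := by
  classical
  rw [contract_single]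
  refine Submodule.sum_mem _ fun γ hγ => ?_
  split_ifs with hle
  · refine Finsupp.single_mem_supported _ _ ?_
    have h1 := hf γ (MvPolynomial.mem_support_iff.mp hγ)
    have h2 : tdeg c = tdeg (c - γ) + tdeg γ := by
      conv_lhs => rw [← tsub_add_cancel_of_le hle]
      simp only [tdeg_eq_degree, map_add]
    show tdeg (c - γ) = t
    omega
  · exact Submodule.zero_mem _

lemma Fk_fg (A : Type) [CommRing A] (n t : ℕ) : (Fk A n t).FG := by
  rw [Fk, Finsupp.supported_eq_span_single]
  exact Submodule.fg_span ((tdeg_finite n t).image _)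

lemma topH_finite (K : Type) [Field K] (m n : ℕ)
    (f : MvPolynomial (Fin n) (MvPolynomial (Fin m) K)) (t b : ℕ) :
    Module.Finite (MvPolynomial (Fin m) K) ↥(topH n K m f t b) :=
  Module.Finite.iff_fg.mpr ((Fk_fg _ n t).map _)

open TensorProduct in
lemma exists_functional (A : Type) [CommRing A] (M : Type) [AddCommGroup M] [Module A M]
    [Module.Finite A M] (p : Ideal A) [hp : p.IsPrime] (h : Module.annihilator A M ≤ p) :
    ∃ φ : M →ₗ[A] p.ResidueField, φ ≠ 0 := by
  have h1 : (⟨p, hp⟩ : PrimeSpectrum A) ∈ Module.support A M :=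
    Module.mem_support_iff_of_finite.mpr h
  rw [Module.mem_support_iff_nontrivial_residueField_tensorProduct] at h1
  change Nontrivial (p.ResidueField ⊗[A] M) at h1
  obtain ⟨x, hx⟩ := exists_ne (0 : p.ResidueField ⊗[A] M)
  obtain ⟨ψ, hψ⟩ : ∃ ψ : Module.Dual p.ResidueField (p.ResidueField ⊗[A] M), ψ x ≠ 0 := by
    by_contra! hcon
    exact hx ((Module.forall_dual_apply_eq_zero_iff p.ResidueField x).mp hcon)
  refine ⟨(ψ.restrictScalars A) ∘ₗ (TensorProduct.mk A p.ResidueField M 1), fun h0 => hψ ?_⟩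
  have h2 : ∀ y : M, ψ (1 ⊗ₜ[A] y) = 0 := fun y => LinearMap.congr_fun h0 y
  induction x using TensorProduct.induction_on with
  | zero => simp
  | tmul r y =>
    have : r ⊗ₜ[A] y = r • ((1 : p.ResidueField) ⊗ₜ[A] y) := by
      rw [TensorProduct.smul_tmul', smul_eq_mul, mul_one]
    rw [this, map_smul, h2, smul_zero]
  | add u v hu hv =>
    rw [map_add]
    by_cases hu0 : ψ u = 0
    · by_cases hv0 : ψ v = 0
      · rw [hu0, hv0, add_zero]
      · exact absurd (hv (fun e => hv0 (by rw [e, map_zero])) hv0) hv0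
    · exact absurd (hu (fun e => hu0 (by rw [e, map_zero])) hu0) hu0

lemma coeffs_le_of_annihilator_le {K : Type} [Field K] {m n : ℕ}
    {f : MvPolynomial (Fin n) (MvPolynomial (Fin m) K)} {a b : ℕ}
    (hf : IsBihom n K m f a b) (t : ℕ) (p : Ideal (MvPolynomial (Fin m) K)) [hp : p.IsPrime]
    (h : Module.annihilator (MvPolynomial (Fin m) K) ↥(topH n K m f t b) ≤ p) :
    Ideal.span (Set.range fun β => MvPolynomial.coeff β f) ≤ p := by
  classical
  have := topH_finite K m n f t b
  obtain ⟨φ, hφ⟩ := exists_functional _ _ p h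
  rw [Ideal.span_le]
  rintro _ ⟨β, rfl⟩
  let A := MvPolynomial (Fin m) K
  let q : ↥(Fk A n t) →ₗ[A] ↥(topH n K m f t b) :=
    ((Uf n K m f t b).mkQ).restrict (fun w hw => Submodule.mem_map_of_mem hw)
  let r : Wmod A n →ₗ[A] ↥(Fk A n t) := Finsupp.restrictDom A A {c | tdeg c = t}
  have hr : ∀ w : ↥(Fk A n t), r w = w := fun w =>
    LinearMap.congr_fun (Finsupp.restrictDom_comp_subtype (M := A) (R := A)
      {c : Fin n →₀ ℕ | tdeg c = t}) w
  let χ : Wmod A n →ₗ[A] p.ResidueField := φ ∘ₗ q ∘ₗ r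
  have key := coeffs_zero_of_functional A n f t b (bihom_y hf) p.ResidueField χ ?_ ?_ ?_ β
  · exact (Ideal.algebraMap_residueField_eq_zero).mp key
  · intro c hc
    have : r (Finsupp.single c 1) = 0 := by
      apply Subtype.ext
      change Finsupp.filter (fun c => c ∈ {c : Fin n →₀ ℕ | tdeg c = t}) (Finsupp.single c 1) = 0
      exact Finsupp.filter_single_of_neg _ hc
    simp [χ, this]
  · by_contra! hcon
    apply hφ
    have hχ : χ = 0 := by
      refine Finsupp.lhom_ext' fun c => LinearMap.ext_ring ?_
      simpa using hcon c
    ext ⟨y, hy⟩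
    obtain ⟨w, hw, rfl⟩ := hy
    have := LinearMap.congr_fun hχ w
    simp only [χ, LinearMap.comp_apply] at this
    rw [hr ⟨w, hw⟩] at this
    exact this
  · intro c hc
    have hm := contract_single_mem A n f t b (bihom_y hf) c hc
    have e := hr ⟨_, hm⟩
    change φ (q (r _)) = 0
    rw [e]
    have : q ⟨_, hm⟩ = 0 := by
      apply Subtype.ext
      change (Uf n K m f t b).mkQ (contract A n f (Finsupp.single c 1)) = 0
      rw [Submodule.mkQ_apply, Submodule.Quotient.mk_eq_zero]
      exact Submodule.mem_map_of_mem (Finsupp.single_mem_supported _ _ hc)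
    rw [this, map_zero]

lemma maximal_of_vars_le {K : Type} [Field K] {m : ℕ} (p : Ideal (MvPolynomial (Fin m) K))
    [hp : p.IsPrime]
    (h : Ideal.span (Set.range (MvPolynomial.X : Fin m → MvPolynomial (Fin m) K)) ≤ p) :
    p.IsMaximal := by
  have hk : (RingHom.ker (MvPolynomial.constantCoeff (σ := Fin m) (R := K))).IsMaximal :=
    RingHom.ker_isMaximal_of_surjective _ fun x => ⟨MvPolynomial.C x, by simp⟩
  have hle : RingHom.ker (MvPolynomial.constantCoeff (σ := Fin m) (R := K)) ≤ p := by
    refine le_trans ?_ h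
    intro x hx
    rw [← Set.image_univ, MvPolynomial.mem_ideal_span_X_image]
    intro ν hν
    by_contra! hcon
    have : ν = 0 := by ext i; simpa using hcon i
    subst this
    exact (MvPolynomial.mem_support_iff.mp hν) hx
  rw [← hk.eq_of_le hp.ne_top hle]
  exact hk

/-- **Proposition (paper, Proposition 3.8).** Let `R = P/fP` with `f` bihomogeneous and let
`I(f) ⊆ P₀` be the ideal generated by all (`P₀`-)coefficients of `f`.  Then
`dim_{P₀} H^n_{P₊}(R)_j ≤ dim P₀/I(f)` for all `j ≤ -n` (written `j = -n-t`).  In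
particular, if `I(f)` is `𝔪`-primary for the graded maximal ideal `𝔪 = (x₁,…,x_m)` of
`P₀`, then `H^n_{P₊}(R)_j` is a `P₀`-module of finite length for all `j ≤ -n`. -/
theorem dim_of_top_local_cohomology_of_hypersurface_le
    (K : Type) [Field K] (m n : ℕ) (hn : 0 < n)
    (f : MvPolynomial (Fin n) (MvPolynomial (Fin m) K)) (a b : ℕ)
    (hf : IsBihom n K m f a b) :
    (∀ t : ℕ,
      ringKrullDim ((MvPolynomial (Fin m) K) ⧸
          Module.annihilator (MvPolynomial (Fin m) K) ↥(topH n K m f t b)) ≤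
        ringKrullDim ((MvPolynomial (Fin m) K) ⧸
          Ideal.span (Set.range fun β => MvPolynomial.coeff β f))) ∧
    ((Ideal.span (Set.range fun β => MvPolynomial.coeff β f)).radical =
        Ideal.span (Set.range (MvPolynomial.X : Fin m → MvPolynomial (Fin m) K)) →
      ∀ t : ℕ, IsFiniteLength (MvPolynomial (Fin m) K) ↥(topH n K m f t b)) := by
  refine ⟨fun t => ?_, fun hrad t => ?_⟩
  · rw [ringKrullDim_quotient, ringKrullDim_quotient]
    refine Order.krullDim_le_of_strictMono
      (fun p => ⟨p.1, coeffs_le_of_annihilator_le hf t p.1.asIdeal p.2⟩) fun {_ _} lt => lt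
  · have := topH_finite K m n f t b
    rw [isFiniteLength_iff_isNoetherian_isArtinian]
    refine ⟨inferInstance, ?_⟩
    let I := Module.annihilator (MvPolynomial (Fin m) K) ↥(topH n K m f t b)
    have hdim : Ring.KrullDimLE 0 (MvPolynomial (Fin m) K ⧸ I) := by
      refine Ring.KrullDimLE.mk₀ fun J hJ => ?_
      have hp : (J.comap (Ideal.Quotient.mk I)).IsPrime := inferInstance
      have hle : I ≤ J.comap (Ideal.Quotient.mk I) := by
        intro x hx
        rw [Ideal.mem_comap, Ideal.Quotient.eq_zero_iff_mem.mpr hx]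
        exact J.zero_mem
      have h1 := coeffs_le_of_annihilator_le hf t _ hle
      rw [← hp.radical_le_iff, hrad] at h1
      have h2 := maximal_of_vars_le _ h1
      rw [← Ideal.map_comap_of_surjective _ Ideal.Quotient.mk_surjective J]
      refine (Ideal.map_eq_top_or_isMaximal_of_surjective _ Ideal.Quotient.mk_surjective
        h2).resolve_left ?_
      rw [Ideal.map_comap_of_surjective _ Ideal.Quotient.mk_surjective J]
      exact hJ.ne_top
    have hart : IsArtinianRing (MvPolynomial (Fin m) K ⧸ I) := isArtinianRing_iff_krullDimLE_zero.mpr hdim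
    let : Module (MvPolynomial (Fin m) K ⧸ I) ↥(topH n K m f t b) := Module.quotientAnnihilator
    have : IsScalarTower (MvPolynomial (Fin m) K) (MvPolynomial (Fin m) K ⧸ I)
        ↥(topH n K m f t b) := by
      refine ⟨fun x y z => ?_⟩
      obtain ⟨y, rfl⟩ := Ideal.Quotient.mk_surjective y
      exact mul_smul x y z
    have hfin : Module.Finite (MvPolynomial (Fin m) K ⧸ I) ↥(topH n K m f t b) :=
      Module.Finite.of_restrictScalars_finite (MvPolynomial (Fin m) K) _ _
    have : IsArtinian (MvPolynomial (Fin m) K ⧸ I) ↥(topH n K m f t b) := inferInstance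
    exact isArtinian_of_surjective_algebraMap (R := MvPolynomial (Fin m) K ⧸ I)
      Ideal.Quotient.mk_surjective

end Paper
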